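/- Let S be a 7-progression-free subset of F_7^2 with |S| = 36. Then there are at least 18 affine lines ℓ of F_7^2 with |ℓ ∩ S| = 6. -/

import Mathlib

/-- A subset `S` of `F_p^n` is `k`-progression-free if there are no `a, d` with `d ≠ 0`
such that `a + i • d ∈ S` for all `i ∈ {0, …, k-1}`. -/
def ProgFree (p n k : ℕ) (S : Finset (Fin n → ZMod p)) : Prop :=
  ¬ ∃ a d : Fin n → ZMod p, d ≠ 0 ∧ ∀ i : ℕ, i < k → a + (i : ZMod p) • d ∈ S

/-- An affine line of `F_7^2`, as a finite set of points. -/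
def IsLine (L : Finset (Fin 2 → ZMod 7)) : Prop :=
  ∃ a d : Fin 2 → ZMod 7, d ≠ 0 ∧
    L = Finset.image (fun t : ZMod 7 => a + t • d) Finset.univ

/-- Linear form whose level sets are the lines with slope `m` (vertical for `none`). -/
def lf (m : Option (ZMod 7)) (p : Fin 2 → ZMod 7) : ZMod 7 :=
  match m with
  | none => p 0
  | some m => p 1 - m * p 0

/-- The line with slope `i.1` and intercept `i.2`. -/
def ln (i : Option (ZMod 7) × ZMod 7) : Finset (Fin 2 → ZMod 7) :=
  Finset.univ.filter (fun p => lf i.1 p = i.2)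

theorem mem_ln (i : Option (ZMod 7) × ZMod 7) (p : Fin 2 → ZMod 7) :
    p ∈ ln i ↔ lf i.1 p = i.2 := by simp [ln]

theorem ln_isLine (i : Option (ZMod 7) × ZMod 7) : IsLine (ln i) := by
  obtain ⟨m, c⟩ := i
  cases m with
  | none =>
    refine ⟨![c, 0], ![0, 1], ?_, ?_⟩
    · intro h
      have := congrFun h 1
      simp at this
      exact absurd this (by decide)
    · ext p
      simp only [mem_ln, lf, Finset.mem_image, Finset.mem_univ, true_and]
      constructor
      · intro h
        refine ⟨p 1, ?_⟩
        ext j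
        fin_cases j <;> simp [h]
      · rintro ⟨t, rfl⟩
        simp
  | some m =>
    refine ⟨![0, c], ![1, m], ?_, ?_⟩
    · intro h
      have := congrFun h 0
      simp at this
      exact absurd this (by decide)
    · ext p
      simp only [mem_ln, lf, Finset.mem_image, Finset.mem_univ, true_and]
      constructor
      · intro h
        refine ⟨p 0, ?_⟩
        ext j
        fin_cases j
        · simp
        · simp [← h]; ring
      · rintro ⟨t, rfl⟩
        simp; ring

theorem ln_inj : Function.Injective ln := by
  rintro ⟨m, c⟩ ⟨m', c'⟩ h
  have key : ∀ p, lf m p = c ↔ lf m' p = c' := by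
    intro p
    have := congrArg (fun L => p ∈ L) h
    simpa [mem_ln] using this
  cases m with
  | none =>
    have h0 := (key ![c, 0]).1 (by simp [lf])
    have h1 := (key ![c, 1]).1 (by simp [lf])
    cases m' with
    | none => simp [lf] at h0; simp [h0]
    | some m' =>
      simp [lf] at h0 h1
      rw [← h0] at h1
      exact absurd (by linear_combination h1 : (1 : ZMod 7) = 0) (by decide)
  | some m =>
    have h0 := (key ![0, c]).1 (by simp [lf])
    have h1 := (key ![1, m + c]).1 (by simp [lf])
    cases m' with
    | none =>
      simp [lf] at h0 h1
      exact absurd (by linear_combination h1 - h0 : (1 : ZMod 7) = 0) (by decide)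
    | some m' =>
      simp [lf] at h0 h1
      have : m = m' := by linear_combination h1 - h0
      simp [h0, this]

theorem line_le (S : Finset (Fin 2 → ZMod 7)) (hS : ProgFree 7 2 7 S)
    (L : Finset (Fin 2 → ZMod 7)) (hL : IsLine L) : (L ∩ S).card ≤ 6 := by
  by_contra hc
  obtain ⟨a, d, hd, rfl⟩ := hL
  have h7 : (Finset.image (fun t : ZMod 7 => a + t • d) Finset.univ).card ≤ 7 :=
    Finset.card_image_le.trans (by simp [ZMod.card])
  have := Finset.eq_of_subset_of_card_le
    (Finset.inter_subset_left (s₁ := Finset.image (fun t : ZMod 7 => a + t • d) Finset.univ)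
      (s₂ := S)) (by omega)
  rw [Finset.inter_eq_left] at this
  refine hS ⟨a, d, hd, fun i _ => this ?_⟩
  exact Finset.mem_image_of_mem _ (Finset.mem_univ _)

theorem count_dir : ∀ u v : ZMod 7,
    (Finset.univ.filter (fun m : Option (ZMod 7) => lf m ![u, v] = 0)).card
      = if u = 0 ∧ v = 0 then 8 else 1 := by
  decide

theorem count_pair (p q : Fin 2 → ZMod 7) :
    (∑ m : Option (ZMod 7), if lf m p = lf m q then (1 : ℤ) else 0)
      = 1 + if p = q then 7 else 0 := by
  have h := count_dir (p 0 - q 0) (p 1 - q 1)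
  have e : ∀ m, lf m ![p 0 - q 0, p 1 - q 1] = 0 ↔ lf m p = lf m q := by
    intro m
    cases m with
    | none => simp [lf, sub_eq_zero]
    | some m =>
      simp only [lf, Matrix.cons_val_zero, Matrix.cons_val_one]
      rw [← sub_eq_zero (a := p 1 - m * p 0)]
      ring_nf
  have e2 : (p 0 - q 0 = 0 ∧ p 1 - q 1 = 0) ↔ p = q := by
    simp [sub_eq_zero, funext_iff, Fin.forall_fin_two]
  simp only [e, e2] at h
  rw [Finset.sum_boole, h]
  split_ifs <;> norm_num

theorem card_ln (S : Finset (Fin 2 → ZMod 7)) (i : Option (ZMod 7) × ZMod 7) :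
    ((ln i ∩ S).card : ℤ) = ∑ p ∈ S, if lf i.1 p = i.2 then 1 else 0 := by
  rw [Finset.sum_boole]
  congr 2
  ext p
  simp [mem_ln, and_comm]

theorem sum_one (S : Finset (Fin 2 → ZMod 7)) :
    ∑ i, ((ln i ∩ S).card : ℤ) = 8 * S.card := by
  simp only [card_ln]
  rw [Finset.sum_comm]
  simp only [Fintype.sum_prod_type, Finset.sum_ite_eq]
  simp [ZMod.card, mul_comm]

theorem sum_two (S : Finset (Fin 2 → ZMod 7)) :
    ∑ i, ((ln i ∩ S).card : ℤ) ^ 2 = S.card * (S.card + 7) := by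
  have h : ∀ i, ((ln i ∩ S).card : ℤ) ^ 2
      = ∑ p ∈ S, ∑ q ∈ S, if lf i.1 p = i.2 then (if lf i.1 q = i.2 then 1 else 0) else 0 := by
    intro i
    rw [card_ln, sq, Finset.sum_mul_sum]
    simp only [ite_mul, one_mul, zero_mul]
  simp only [h]
  rw [Finset.sum_comm]
  have h2 : ∀ p ∈ S, (∑ i : Option (ZMod 7) × ZMod 7, ∑ q ∈ S,
      if lf i.1 p = i.2 then (if lf i.1 q = i.2 then (1 : ℤ) else 0) else 0) = S.card + 7 := by
    intro p hp
    rw [Finset.sum_comm]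
    have h3 : ∀ q ∈ S, (∑ i : Option (ZMod 7) × ZMod 7,
        if lf i.1 p = i.2 then (if lf i.1 q = i.2 then (1 : ℤ) else 0) else 0)
        = 1 + if p = q then 7 else 0 := by
      intro q _
      rw [← count_pair, Fintype.sum_prod_type]
      refine Finset.sum_congr rfl fun m _ => ?_
      simp only [Finset.sum_ite_eq]
      simp [eq_comm]
    rw [Finset.sum_congr rfl h3, Finset.sum_add_distrib, Finset.sum_ite_eq]
    simp [hp]
  rw [Finset.sum_congr rfl h2]
  simp

theorem stmt_11 (S : Finset (Fin 2 → ZMod 7)) (hS : ProgFree 7 2 7 S)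
    (hcard : S.card = 36) :
    18 ≤ {L : Finset (Fin 2 → ZMod 7) | IsLine L ∧ (L ∩ S).card = 6}.ncard := by
  have hpt : ∀ i, ((ln i ∩ S).card : ℤ) ^ 2 - 5 * ((ln i ∩ S).card : ℤ)
      ≤ 6 * (if (ln i ∩ S).card = 6 then 1 else 0) := by
    intro i
    have := line_le S hS _ (ln_isLine i)
    generalize (ln i ∩ S).card = s at *
    interval_cases s <;> simp
  have hsum := Finset.sum_le_sum (fun i (_ : i ∈ Finset.univ) => hpt i)
  rw [Finset.sum_sub_distrib, ← Finset.mul_sum, ← Finset.mul_sum, sum_one, sum_two, hcard,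
    Finset.sum_boole] at hsum
  have h18 : 18 ≤ (Finset.univ.filter (fun i => (ln i ∩ S).card = 6)).card := by
    push_cast at hsum
    omega
  rw [← Finset.card_image_of_injective _ ln_inj, ← Set.ncard_coe_finset] at h18
  refine h18.trans (Set.ncard_le_ncard ?_ (Set.toFinite _))
  intro L hL
  simp only [Finset.coe_image, Set.mem_image, Finset.coe_filter, Finset.mem_univ, true_and,
    Set.mem_ofPred_eq] at hL
  obtain ⟨i, hi, rfl⟩ := hL
  exact ⟨ln_isLine i, hi⟩
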